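/- Let μ > -1/2 and v ∈ ℝ. There exists a constant C_μ such that the Bessel function of complex order satisfies |J_{μ+iv}(ρ) - (2/(πρ))^{1/2} cos(ρ - (π/2)(μ+iv) - π/4)| ≤ C_μ e^{π|v|} ρ^{-3/2} for all ρ > 1. -/

import Mathlib

open Complex

/-- Bessel function of the first kind of complex order ν with Re ν > -1/2,
defined by the Poisson integral representation. -/
noncomputable def besselJ (ν : ℂ) (ρ : ℝ) : ℂ :=
  ((ρ / 2 : ℂ) ^ ν / (Complex.Gamma (ν + 1 / 2) * Complex.Gamma (1 / 2))) *
    ∫ t in (-1 : ℝ)..1, Complex.exp (I * ρ * t) * ((1 - (t : ℂ) ^ 2) ^ (ν - 1 / 2))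


lemma bj_half (v : ℝ) : Real.pi * Real.exp (-(Real.pi * |v|)) ≤ ‖Complex.Gamma ((1/2 : ℝ) + v * I)‖ ^ 2 := by
  have h := Complex.Gamma_mul_Gamma_one_sub ((1/2 : ℝ) + v * I)
  have h1 : (1 : ℂ) - ((1/2 : ℝ) + v * I) = (starRingEnd ℂ) ((1/2 : ℝ) + v * I) := by
    rw [map_add, map_mul, Complex.conj_ofReal, Complex.conj_ofReal, Complex.conj_I]
    push_cast; ring
  rw [h1, Complex.Gamma_conj, Complex.mul_conj, Complex.normSq_eq_norm_sq] at h
  have h2 : Complex.sin (Real.pi * ((1/2 : ℝ) + v * I)) = (Real.cosh (Real.pi * v) : ℝ) := by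
    have : (Real.pi : ℂ) * ((1/2 : ℝ) + v * I) = ((Real.pi * v : ℝ) : ℂ) * I + Real.pi / 2 := by
      push_cast; ring
    rw [this, Complex.sin_add_pi_div_two, Complex.cos_mul_I]
    simp
  rw [h2, ← Complex.ofReal_div] at h
  have h3 := Complex.ofReal_injective h
  rw [h3, Real.exp_neg, ← div_eq_mul_inv]
  have : Real.cosh (Real.pi * v) ≤ Real.exp (Real.pi * |v|) := by
    rw [← Real.cosh_abs, abs_mul, abs_of_pos Real.pi_pos, Real.cosh_eq]
    have : Real.exp (-(Real.pi * |v|)) ≤ Real.exp (Real.pi * |v|) := by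
      apply Real.exp_le_exp.mpr
      have : 0 ≤ Real.pi * |v| := by positivity
      linarith
    linarith
  have := Real.cosh_pos (Real.pi * v)
  gcongr

lemma bj_gamma (x : ℝ) (hx : 0 < x) : ∃ C : ℝ, 0 < C ∧ ∀ v : ℝ,
    ‖(Complex.Gamma (x + v * I))⁻¹‖ ≤ C * (1 + |v|) * Real.exp (Real.pi / 2 * |v|) := by
  set B : ℝ := ∫ t in (0:ℝ)..1, ‖(t:ℂ) ^ (((1/2 : ℝ) : ℂ) - 1) * (1 - (t:ℂ)) ^ (((x+1/2 : ℝ) : ℂ) - 1)‖ with hB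
  have hB0 : 0 ≤ B := intervalIntegral.integral_nonneg (by norm_num) (fun _ _ => norm_nonneg _)
  have hG : 0 < Real.Gamma (x + 1/2) := Real.Gamma_pos_of_pos (by linarith)
  set G := Real.Gamma (x+1/2) with hGd
  refine ⟨(x + 1) * (B + 1) / G , by positivity, fun v => ?_⟩
  have hbeta := Complex.Gamma_mul_Gamma_eq_betaIntegral (s := (1/2 : ℝ) + v * I) (t := ((x + 1/2 : ℝ) : ℂ)) (by simp) (by simp; linarith)
  have hn : ‖Complex.betaIntegral ((1/2 : ℝ) + v * I) ((x + 1/2 : ℝ) : ℂ)‖ ≤ B := by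
    rw [Complex.betaIntegral, hB]
    refine (intervalIntegral.norm_integral_le_integral_norm (by norm_num)).trans (le_of_eq ?_)
    apply intervalIntegral.integral_congr_ae
    refine Filter.Eventually.of_forall fun t ht => ?_
    rw [Set.uIoc_of_le (by norm_num)] at ht
    rw [norm_mul, norm_mul]
    congr 1
    rw [Complex.norm_cpow_eq_rpow_re_of_pos ht.1, Complex.norm_cpow_eq_rpow_re_of_pos ht.1]
    simp
  have harg : ((1/2 : ℝ) + v * I : ℂ) + ((x + 1/2 : ℝ) : ℂ) = (x + v * I) + 1 := by push_cast; ring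
  have hz : (x + v * I : ℂ) ≠ 0 := by
    intro h
    have := congrArg Complex.re h
    simp at this; linarith
  rw [harg, Complex.Gamma_add_one _ hz, Complex.Gamma_ofReal] at hbeta
  have hb := congrArg norm hbeta
  rw [norm_mul, norm_mul, norm_mul, Complex.norm_real, Real.norm_of_nonneg hG.le] at hb
  have hzn : ‖(x + v * I : ℂ)‖ ≤ (x + 1) * (1 + |v|) := by
    refine (norm_add_le _ _).trans ?_
    simp only [norm_mul, Complex.norm_real, Complex.norm_I, Real.norm_eq_abs, abs_of_pos hx]
    nlinarith [abs_nonneg v]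
  have hh := bj_half v
  have hexp : Real.exp (-(Real.pi / 2 * |v|)) ≤ ‖Complex.Gamma ((1/2 : ℝ) + v * I)‖ := by
    apply le_of_sq_le_sq _ (norm_nonneg _)
    rw [← Real.exp_nat_mul]
    refine le_trans ?_ hh
    have : ((2:ℕ):ℝ) * -(Real.pi / 2 * |v|) = -(Real.pi * |v|) := by push_cast; ring
    rw [this]
    have := Real.pi_gt_three
    nlinarith [Real.exp_pos (-(Real.pi * |v|))]
  have hGne : 0 < ‖Complex.Gamma (x + v * I)‖ := by
    rw [norm_pos_iff]
    apply Complex.Gamma_ne_zero_of_re_pos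
    simpa using hx
  rw [norm_inv, inv_le_iff_one_le_mul₀ hGne]
  have h1 : Real.exp (-(Real.pi / 2 * |v|)) * G ≤ ((x + 1) * (1 + |v|) * ‖Complex.Gamma (x + v * I)‖) * (B + 1) := by
    calc _ ≤ ‖Complex.Gamma ((1/2 : ℝ) + v * I)‖ * G := by gcongr
      _ ≤ _ := by
        rw [hb]
        gcongr
        linarith
  rw [Real.exp_neg] at h1
  have he := Real.exp_pos (Real.pi / 2 * |v|)
  rw [inv_mul_le_iff₀ he] at h1
  have : 1 ≤ (Real.exp (Real.pi / 2 * |v|) * ((x + 1) * (1 + |v|) * ‖Complex.Gamma (x + v * I)‖ * (B + 1))) / G := by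
    rw [le_div_iff₀ hG]; linarith
  refine this.trans (le_of_eq ?_)
  ring

lemma bj_cpow {z : ℂ} (hz : z ≠ 0) (hr : 0 ≤ z.re) (p : ℂ) :
    ‖z ^ p‖ ≤ ‖z‖ ^ p.re * Real.exp (Real.pi / 2 * |p.im|) := by
  rw [Complex.norm_cpow_of_ne_zero hz, div_eq_mul_inv, ← Real.exp_neg]
  gcongr
  have h := Complex.abs_arg_le_pi_div_two_iff.mpr hr
  calc -(z.arg * p.im) ≤ |z.arg * p.im| := neg_le_abs _
    _ = |z.arg| * |p.im| := abs_mul _ _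
    _ ≤ _ := by gcongr

lemma bj_exp (p : ℝ) : ∃ D : ℝ, 0 < D ∧ ∀ y : ℝ, 0 ≤ y → ∀ w : ℝ, 1 ≤ w → w ≤ y + 2 →
    w ^ p ≤ D * Real.exp (y / 2) := by
  obtain ⟨N, hN⟩ := exists_nat_ge p
  refine ⟨2 ^ N * N.factorial * Real.exp 1, by positivity, fun y hy w hw hwy => ?_⟩
  have h1 := Real.pow_div_factorial_le_exp (w / 2) (by linarith) N
  rw [div_le_iff₀ (by positivity), div_pow, div_le_iff₀ (by positivity)] at h1
  calc w ^ p ≤ w ^ (N : ℝ) := Real.rpow_le_rpow_of_exponent_le hw hN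
    _ = w ^ N := Real.rpow_natCast _ _
    _ ≤ _ := h1
    _ ≤ Real.exp (1 + y / 2) * N.factorial * 2 ^ N := by gcongr; linarith
    _ = _ := by rw [Real.exp_add]; ring

lemma bj_norm {s : ℂ} (hs : s = I ∨ s = -I) {y : ℝ} (hy : 0 ≤ y) :
    ((y : ℂ) + 2 * s) ∈ Complex.slitPlane ∧ 0 ≤ ((y : ℂ) + 2 * s).re ∧ 1 ≤ ‖(y : ℂ) + 2 * s‖
      ∧ ‖(y : ℂ) + 2 * s‖ ≤ y + 2 := by
  have hsn : ‖s‖ = 1 := by rcases hs with rfl | rfl <;> simp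
  have him : |((y : ℂ) + 2 * s).im| = 2 := by rcases hs with rfl | rfl <;> simp
  refine ⟨?_, ?_, ?_, ?_⟩
  · right
    intro h
    rw [h] at him; norm_num at him
  · rcases hs with rfl | rfl <;> simpa using hy
  · have := Complex.abs_im_le_norm ((y : ℂ) + 2 * s)
    linarith
  · refine (norm_add_le _ _).trans ?_
    simp [hsn, abs_of_nonneg hy]

lemma bj_deriv {s : ℂ} (hs : s = I ∨ s = -I) (p : ℂ) {y : ℝ} (hy : 0 ≤ y) :
    HasDerivAt (fun x : ℝ => ((x : ℂ) + 2 * s) ^ p) (p * ((y : ℂ) + 2 * s) ^ (p - 1)) y := by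
  have h0 : HasDerivAt (fun x : ℂ => x + 2 * s) 1 (y : ℂ) := (hasDerivAt_id _).add_const _
  have := (h0.cpow_const (c := p) (bj_norm hs hy).1).comp_ofReal
  simpa using this

lemma bj_taylor (b : ℝ) : ∃ D : ℝ, 0 < D ∧ ∀ s : ℂ, (s = I ∨ s = -I) → ∀ v y : ℝ, 0 ≤ y →
    ‖((y : ℂ) + 2 * s) ^ (b + v * I : ℂ) - (2 * s) ^ (b + v * I : ℂ)
      - (b + v * I) * (2 * s) ^ ((b + v * I : ℂ) - 1) * y‖ ≤
      D * (1 + |v|) ^ 2 * Real.exp (Real.pi / 2 * |v|) * Real.exp (y / 2) * y ^ 2 := by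
  obtain ⟨D, hD, hDb⟩ := bj_exp (b - 2)
  refine ⟨(|b| + 2) ^ 2 * D, by positivity, fun s hs v y hy => ?_⟩
  set a : ℂ := b + v * I with ha
  have ha1 : ‖a‖ ≤ (|b| + 2) * (1 + |v|) := by
    refine (norm_add_le _ _).trans ?_
    simp only [norm_mul, Complex.norm_real, Complex.norm_I, Real.norm_eq_abs]
    nlinarith [abs_nonneg v, abs_nonneg b]
  have ha2 : ‖a - 1‖ ≤ (|b| + 2) * (1 + |v|) := by
    refine (norm_sub_le _ _).trans ?_
    have := norm_add_le (b : ℂ) (v * I)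
    rw [← ha] at this
    simp only [norm_mul, Complex.norm_real, Complex.norm_I, Real.norm_eq_abs, norm_one] at this ⊢
    nlinarith [abs_nonneg v, abs_nonneg b]
  set K : ℝ := (|b| + 2) ^ 2 * D * (1 + |v|) ^ 2 * Real.exp (Real.pi / 2 * |v|) * Real.exp (y / 2) with hK
  have hK0 : 0 ≤ K := by positivity
  have h2 : ∀ x ∈ Set.Icc (0:ℝ) y, ‖a * ((a - 1) * ((x : ℂ) + 2 * s) ^ (a - 1 - 1))‖ ≤ K := by
    intro x hx
    obtain ⟨n1, n2, n3, n4⟩ := bj_norm hs hx.1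
    have e1 := bj_cpow (Complex.slitPlane_ne_zero n1) n2 (a - 1 - 1)
    have e2 := hDb y hy _ n3 (n4.trans (by linarith [hx.2]))
    have r1 : (a - 1 - 1).re = b - 2 := by simp [ha]; ring
    have r2 : (a - 1 - 1).im = v := by simp [ha]
    rw [r1, r2] at e1
    rw [norm_mul, norm_mul]
    calc _ ≤ ((|b| + 2) * (1 + |v|)) * (((|b| + 2) * (1 + |v|)) * ((D * Real.exp (y / 2)) * Real.exp (Real.pi / 2 * |v|))) := by
          gcongr
          exact e1.trans (by gcongr)
      _ = K := by rw [hK]; ring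
  have hconv : Convex ℝ (Set.Icc (0:ℝ) y) := convex_Icc (0:ℝ) y
  have h1 : ∀ x ∈ Set.Icc (0:ℝ) y, ‖a * ((x : ℂ) + 2 * s) ^ (a - 1) - a * (2 * s) ^ (a - 1)‖ ≤ K * y := by
    intro x hx
    have := hconv.norm_image_sub_le_of_norm_hasDerivWithin_le
      (f := fun x : ℝ => a * ((x : ℂ) + 2 * s) ^ (a - 1)) (x := 0) (y := x) (C := K)
      (fun x hx => ((bj_deriv hs (a - 1) hx.1).const_mul a).hasDerivWithinAt) h2 ⟨le_rfl, hy⟩ hx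
    simp only [Complex.ofReal_zero, zero_add, sub_zero] at this
    refine this.trans ?_
    rw [Real.norm_of_nonneg hx.1]
    gcongr
    exact hx.2
  have h0 := hconv.norm_image_sub_le_of_norm_hasDerivWithin_le
      (f := fun x : ℝ => ((x : ℂ) + 2 * s) ^ a - x * (a * (2 * s) ^ (a - 1))) (x := 0) (y := y) (C := K * y)
      (fun x hx => ((bj_deriv hs a hx.1).sub ((Complex.ofRealCLM.hasDerivAt (x := x)).mul_const _)).hasDerivWithinAt)
      (fun x hx => by simpa using h1 x hx) ⟨le_rfl, hy⟩ ⟨hy, le_rfl⟩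
  simp only [Complex.ofReal_zero, zero_add, sub_zero, zero_mul] at h0
  rw [Real.norm_of_nonneg hy] at h0
  calc _ = ‖((y : ℂ) + 2 * s) ^ a - y * (a * (2 * s) ^ (a - 1)) - (2 * s) ^ a‖ := by congr 1; ring
    _ ≤ _ := h0
    _ = _ := by ring

lemma bj_int {q r : ℝ} (hq : -1 < q) (hr : 0 < r) :
    MeasureTheory.IntegrableOn (fun y : ℝ => y ^ q * Real.exp (-(r * y))) (Set.Ioi 0) := by
  have := integrableOn_rpow_mul_exp_neg_mul_rpow (p := 1) (s := q) (b := r) hq one_pos hr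
  simpa using this

lemma bj_meas (a p : ℂ) (ρ : ℝ) {s : ℂ} (hs : s = I ∨ s = -I) :
    MeasureTheory.AEStronglyMeasurable
      (fun y : ℝ => (y : ℂ) ^ a * Complex.exp (-(ρ * y)) * ((y : ℂ) + 2 * s) ^ p)
      (MeasureTheory.volume.restrict (Set.Ioi 0)) := by
  refine ContinuousOn.aestronglyMeasurable ?_ measurableSet_Ioi
  intro y hy
  apply ContinuousAt.continuousWithinAt
  refine ContinuousAt.mul (ContinuousAt.mul ?_ ?_) ?_
  · exact Complex.continuousAt_ofReal_cpow_const _ _ (Or.inr (ne_of_gt hy))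
  · fun_prop
  · exact (bj_deriv hs p (le_of_lt hy)).continuousAt

lemma bj_integrable (b v ρ : ℝ) (hb : -1 < b) (hρ : 1 < ρ) {s : ℂ} (hs : s = I ∨ s = -I) :
    MeasureTheory.IntegrableOn (fun y : ℝ => (y : ℂ) ^ (b + v * I : ℂ) * Complex.exp (-(ρ * y)) *
      ((y : ℂ) + 2 * s) ^ (b + v * I : ℂ)) (Set.Ioi 0) := by
  obtain ⟨D, hD, hDb⟩ := bj_exp b
  have h := (bj_int (q := b) (r := ρ - 1 / 2) hb (by linarith)).const_mul (D * Real.exp (Real.pi / 2 * |v|))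
  refine MeasureTheory.Integrable.mono' h (bj_meas _ _ _ hs) ?_
  refine (MeasureTheory.ae_restrict_iff' measurableSet_Ioi).mpr (Filter.Eventually.of_forall fun y hy => ?_)
  have hy0 : 0 < y := hy
  obtain ⟨n1, n2, n3, n4⟩ := bj_norm hs hy0.le
  have e1 := bj_cpow (Complex.slitPlane_ne_zero n1) n2 (b + v * I)
  have e2 := hDb y hy0.le _ n3 n4
  rw [norm_mul, norm_mul, Complex.norm_cpow_eq_rpow_re_of_pos hy0, Complex.norm_exp]
  have r1 : (b + v * I : ℂ).re = b := by simp
  have r2 : (b + v * I : ℂ).im = v := by simp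
  have r3 : (-((ρ : ℂ) * y)).re = -(ρ * y) := by simp
  rw [r1, r2] at e1
  rw [r1, r3]
  calc _ ≤ y ^ b * Real.exp (-(ρ * y)) * (D * Real.exp (y / 2) * Real.exp (Real.pi / 2 * |v|)) := by
        gcongr
        exact e1.trans (by gcongr)
    _ = _ := by
        rw [show -((ρ - 1/2) * y) = -(ρ * y) + y / 2 by ring, Real.exp_add]; ring

lemma bj_asymp (b : ℝ) (hb : -1 < b) : ∃ C : ℝ, 0 < C ∧ ∀ s : ℂ, (s = I ∨ s = -I) →
    ∀ v ρ : ℝ, 1 < ρ → ∀ a : ℂ, a = b + v * I →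
    ‖(∫ y in Set.Ioi (0:ℝ), (y : ℂ) ^ a * Complex.exp (-(ρ * y)) * ((y : ℂ) + 2 * s) ^ a)
      - (2 * s) ^ a * ((1 / (ρ:ℂ)) ^ (a + 1) * Complex.Gamma (a + 1))
      - a * (2 * s) ^ (a - 1) * ((1 / (ρ:ℂ)) ^ (a + 2) * Complex.Gamma (a + 2))‖ ≤
    C * (1 + |v|) ^ 2 * Real.exp (Real.pi / 2 * |v|) * ρ ^ (-b - 3) := by
  obtain ⟨D, hD, hDb⟩ := bj_taylor b
  have hG : 0 < Real.Gamma (b + 3) := Real.Gamma_pos_of_pos (by linarith)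
  refine ⟨D * (2 ^ (b + 3) * Real.Gamma (b + 3)), by positivity, ?_⟩
  rintro s hs v ρ hρ a ha
  have hρ0 : 0 < ρ := by linarith
  have i1 := Complex.integral_cpow_mul_exp_neg_mul_Ioi (a := a + 1) (r := ρ) (by simp [ha]; linarith) hρ0
  have i2 := Complex.integral_cpow_mul_exp_neg_mul_Ioi (a := a + 2) (r := ρ) (by simp [ha]; linarith) hρ0
  have g0 := bj_integrable b v ρ hb hρ hs
  rw [← ha] at g0
  have gi : ∀ p : ℂ, -1 < p.re → MeasureTheory.IntegrableOn
      (fun y : ℝ => (y : ℂ) ^ p * Complex.exp (-(ρ * y))) (Set.Ioi 0) := by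
    intro p hp
    have m := bj_meas p 0 ρ (s := I) (Or.inl rfl)
    simp only [Complex.cpow_zero, mul_one] at m
    refine MeasureTheory.Integrable.mono' (bj_int hp hρ0) m ?_
    refine (MeasureTheory.ae_restrict_iff' measurableSet_Ioi).mpr (Filter.Eventually.of_forall fun y hy => ?_)
    have hy0 : 0 < y := hy
    rw [norm_mul, Complex.norm_cpow_eq_rpow_re_of_pos hy0, Complex.norm_exp]
    simp
  have g1 := gi (a + 1 - 1) (by simp [ha]; linarith)
  have g2 := gi (a + 2 - 1) (by simp [ha]; linarith)
  have g01 : MeasureTheory.IntegrableOn (fun y : ℝ =>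
      (y : ℂ) ^ a * Complex.exp (-(ρ * y)) * ((y : ℂ) + 2 * s) ^ a
        - (2 * s) ^ a * ((y : ℂ) ^ (a + 1 - 1) * Complex.exp (-(ρ * y)))) (Set.Ioi 0) :=
    g0.sub (g1.const_mul _)
  rw [← i1, ← i2, ← MeasureTheory.integral_const_mul, ← MeasureTheory.integral_const_mul,
    ← MeasureTheory.integral_sub g0 (g1.const_mul _),
    ← MeasureTheory.integral_sub g01 (g2.const_mul _)]
  have hbound := (bj_int (q := b + 3 - 1) (r := ρ / 2) (by linarith) (by linarith)).const_mul
    (D * (1 + |v|) ^ 2 * Real.exp (Real.pi / 2 * |v|))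
  refine (MeasureTheory.norm_integral_le_of_norm_le hbound ?_).trans (le_of_eq ?_)
  · refine (MeasureTheory.ae_restrict_iff' measurableSet_Ioi).mpr (Filter.Eventually.of_forall fun y hy => ?_)
    have hy0 : 0 < y := hy
    have hyc : (y : ℂ) ≠ 0 := by exact_mod_cast hy0.ne'
    have e := hDb s hs v y hy0.le
    rw [← ha] at e
    have eq1 : (y : ℂ) ^ (a + 2 - 1) = (y : ℂ) ^ a * y := by
      rw [show a + 2 - 1 = a + 1 by ring, Complex.cpow_add _ _ hyc, Complex.cpow_one]
    rw [eq1, show a + 1 - 1 = a by ring]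
    have eq2 : (y : ℂ) ^ a * Complex.exp (-(ρ * y)) * ((y : ℂ) + 2 * s) ^ a
        - (2 * s) ^ a * ((y : ℂ) ^ a * Complex.exp (-(ρ * y)))
        - a * (2 * s) ^ (a - 1) * ((y : ℂ) ^ a * y * Complex.exp (-(ρ * y)))
        = (y : ℂ) ^ a * Complex.exp (-(ρ * y)) * (((y : ℂ) + 2 * s) ^ a - (2 * s) ^ a
          - a * (2 * s) ^ (a - 1) * y) := by ring
    rw [eq2, norm_mul, norm_mul, Complex.norm_cpow_eq_rpow_re_of_pos hy0, Complex.norm_exp]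
    have r1 : a.re = b := by simp [ha]
    have r3 : (-((ρ : ℂ) * y)).re = -(ρ * y) := by simp
    rw [r1, r3]
    have e5 : Real.exp (-(ρ * y)) * Real.exp (y / 2) ≤ Real.exp (-(ρ / 2 * y)) := by
      rw [← Real.exp_add]
      apply Real.exp_le_exp.mpr
      nlinarith
    have e6 : y ^ (b + 3 - 1) = y ^ b * y ^ 2 := by
      rw [show b + 3 - 1 = b + (2:ℕ) by push_cast; ring, Real.rpow_add hy0, Real.rpow_natCast]
    calc _ ≤ y ^ b * Real.exp (-(ρ * y)) * (D * (1 + |v|) ^ 2 * Real.exp (Real.pi / 2 * |v|) * Real.exp (y / 2) * y ^ 2) := by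
          gcongr
      _ = D * (1 + |v|) ^ 2 * Real.exp (Real.pi / 2 * |v|) * (y ^ b * y ^ 2 * (Real.exp (-(ρ * y)) * Real.exp (y / 2))) := by ring
      _ ≤ _ := by
        rw [e6]
        gcongr
  · rw [MeasureTheory.integral_const_mul, Real.integral_rpow_mul_exp_neg_mul_Ioi (by linarith) (by linarith)]
    rw [show 1 / (ρ / 2) = 2 * ρ⁻¹ by field_simp, Real.mul_rpow (by norm_num) (by positivity),
      Real.inv_rpow hρ0.le, ← Real.rpow_neg hρ0.le, show -(b + 3) = -b - 3 by ring]
    ring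

noncomputable def bjF (a : ℂ) (ρ : ℝ) (z : ℂ) : ℂ := Complex.exp (I * ρ * z) * (1 - z ^ 2) ^ a

lemma bj_re (z : ℂ) : (1 - z ^ 2).re = 1 - z.re ^ 2 + z.im ^ 2 := by
  simp [pow_two]; ring

lemma bjF_diff (a : ℂ) (ρ : ℝ) {z : ℂ} (hz : 0 < 1 - z.re ^ 2 + z.im ^ 2) :
    DifferentiableAt ℂ (bjF a ρ) z := by
  unfold bjF
  refine DifferentiableAt.mul (by fun_prop) (DifferentiableAt.cpow_const (by fun_prop) ?_)
  left
  rwa [bj_re]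

lemma bjF_norm (b v ρ : ℝ) {z : ℂ} (hz : 0 < 1 - z.re ^ 2 + z.im ^ 2) :
    ‖bjF (b + v * I) ρ z‖ ≤ Real.exp (-(ρ * z.im)) * (‖1 - z ^ 2‖ ^ b * Real.exp (Real.pi / 2 * |v|)) := by
  unfold bjF
  rw [← bj_re] at hz
  rw [norm_mul, Complex.norm_exp]
  have h1 : (1 - z ^ 2) ≠ 0 := by
    intro h; rw [h] at hz; simp at hz
  have := bj_cpow h1 hz.le (b + v * I)
  have r1 : (b + v * I : ℂ).re = b := by simp
  have r2 : (b + v * I : ℂ).im = v := by simp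
  have r3 : (I * ρ * z).re = -(ρ * z.im) := by simp
  rw [r1, r2] at this
  rw [r3]
  gcongr

lemma bj_mul_cpow {y : ℝ} (hy : 0 < y) {w : ℂ} (hw : w ≠ 0) (a : ℂ) :
    ((y : ℂ) * w) ^ a = (y : ℂ) ^ a * w ^ a := by
  have hyc : (y : ℂ) ≠ 0 := by exact_mod_cast hy.ne'
  rw [Complex.cpow_def_of_ne_zero (mul_ne_zero hyc hw), Complex.cpow_def_of_ne_zero hyc,
    Complex.cpow_def_of_ne_zero hw, Complex.log_ofReal_mul hy hw, ← Complex.exp_add,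
    Complex.ofReal_log hy.le]
  ring_nf

lemma bjF_right (a : ℂ) (ρ : ℝ) {y : ℝ} (hy : 0 < y) :
    bjF a ρ (1 + y * I) = Complex.exp (I * ρ) *
      ((y : ℂ) ^ a * Complex.exp (-(ρ * y)) * ((y : ℂ) + 2 * (-I)) ^ a) := by
  have hw := Complex.slitPlane_ne_zero (bj_norm (s := -I) (Or.inr rfl) hy.le).1
  have h : (1 : ℂ) - (1 + y * I) ^ 2 = y * (y + 2 * (-I)) := by
    ring_nf; rw [Complex.I_sq]; ring
  have h2 : I * ρ * (1 + y * I) = I * ρ + -(ρ * y) := by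
    ring_nf; rw [Complex.I_sq]; ring
  rw [bjF, h, bj_mul_cpow hy hw, h2, Complex.exp_add]
  ring

lemma bjF_left (a : ℂ) (ρ : ℝ) {y : ℝ} (hy : 0 < y) :
    bjF a ρ (-1 + y * I) = Complex.exp (-(I * ρ)) *
      ((y : ℂ) ^ a * Complex.exp (-(ρ * y)) * ((y : ℂ) + 2 * I) ^ a) := by
  have hw := Complex.slitPlane_ne_zero (bj_norm (s := I) (Or.inl rfl) hy.le).1
  have h : (1 : ℂ) - (-1 + y * I) ^ 2 = y * (y + 2 * I) := by
    ring_nf; rw [Complex.I_sq]; ring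
  have h2 : I * ρ * (-1 + y * I) = -(I * ρ) + -(ρ * y) := by
    ring_nf; rw [Complex.I_sq]; ring
  rw [bjF, h, bj_mul_cpow hy hw, h2, Complex.exp_add]
  ring

lemma bj_jacobi_int (b : ℝ) (hb : -1 < b) :
    IntervalIntegrable (fun x : ℝ => (1 - x ^ 2) ^ b) MeasureTheory.volume (-1) 1 := by
  have h := (Complex.betaIntegral_convergent (u := ((b + 1 : ℝ) : ℂ)) (v := ((b + 1 : ℝ) : ℂ))
    (by rw [Complex.ofReal_re]; linarith) (by rw [Complex.ofReal_re]; linarith)).norm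
  have h2 := ((h.comp_mul_left (c := 1 / 2)).comp_add_right 1).const_mul ((4:ℝ) ^ b)
  norm_num at h2
  refine h2.congr_ae ?_
  rw [Set.uIoc_of_le (by norm_num)]
  have hne : ∀ᵐ x : ℝ ∂(MeasureTheory.volume.restrict (Set.Ioc (-1:ℝ) 1)), x ≠ 1 :=
    MeasureTheory.ae_restrict_of_ae (MeasureTheory.Measure.ae_ne _ _)
  filter_upwards [hne, MeasureTheory.ae_restrict_mem measurableSet_Ioc] with x hx hx2
  have hx1 : x < 1 := lt_of_le_of_ne hx2.2 hx
  have hx0 := hx2.1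
  have p1 : 0 < (1 / 2) * (x + 1) := by linarith
  have p2 : 0 < 1 - (1 / 2) * (x + 1) := by linarith
  have q1 : 1 / 2 * ‖(x : ℂ) + 1‖ = (1 / 2) * (x + 1) := by
    rw [show (x : ℂ) + 1 = ((x + 1 : ℝ) : ℂ) by push_cast; ring, Complex.norm_real,
      Real.norm_of_nonneg (by linarith)]
  have q2 : ‖1 - (1:ℂ) / 2 * ((x : ℂ) + 1)‖ = 1 - (1 / 2) * (x + 1) := by
    rw [show 1 - (1:ℂ) / 2 * ((x : ℂ) + 1) = ((1 - (1 / 2) * (x + 1) : ℝ) : ℂ) by push_cast; ring,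
      Complex.norm_real, Real.norm_of_nonneg p2.le]
  rw [q1, q2, ← Real.mul_rpow p1.le p2.le, ← Real.mul_rpow (by norm_num) (by positivity)]
  congr 1; ring

lemma bj_bottom (b v ρ : ℝ) (hb : -1 < b) (hρ : 1 < ρ) :
    Filter.Tendsto (fun ε : ℝ => ∫ x in (-1:ℝ)..1, bjF (b + v * I) ρ (x + ε * I))
      (nhdsWithin 0 (Set.Ioi 0)) (nhds (∫ x in (-1:ℝ)..1, bjF (b + v * I) ρ x)) := by
  apply intervalIntegral.tendsto_integral_filter_of_dominated_convergence
    (fun x => ((1 - x ^ 2) ^ b + (3:ℝ) ^ b) * Real.exp (Real.pi / 2 * |v|))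
  · refine Filter.Eventually.of_forall fun ε => Measurable.aestronglyMeasurable ?_
    unfold bjF
    fun_prop
  · have h1 : ∀ᶠ ε : ℝ in nhdsWithin 0 (Set.Ioi 0), ε ∈ Set.Ioo (0:ℝ) 1 := Ioo_mem_nhdsGT one_pos
    filter_upwards [h1] with ε hε
    filter_upwards [MeasureTheory.Measure.ae_ne MeasureTheory.volume (1:ℝ)] with x hx hx2
    rw [Set.uIoc_of_le (by norm_num)] at hx2
    have hx1 : x < 1 := lt_of_le_of_ne hx2.2 hx
    have hx0 := hx2.1
    have hxx : 0 < 1 - x ^ 2 := by nlinarith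
    have r1 : ((x : ℂ) + ε * I).re = x := by simp
    have r2 : ((x : ℂ) + ε * I).im = ε := by simp
    have hp : 0 < 1 - ((x : ℂ) + ε * I).re ^ 2 + ((x : ℂ) + ε * I).im ^ 2 := by
      rw [r1, r2]; positivity
    refine (bjF_norm b v ρ hp).trans ?_
    have n1 : 1 - x ^ 2 ≤ ‖1 - ((x : ℂ) + ε * I) ^ 2‖ := by
      refine le_trans ?_ (Complex.re_le_norm _)
      rw [bj_re, r1, r2]; nlinarith
    have n2 : ‖1 - ((x : ℂ) + ε * I) ^ 2‖ ≤ 3 := by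
      refine (norm_sub_le _ _).trans ?_
      rw [norm_one, norm_pow, ← Complex.normSq_eq_norm_sq, Complex.normSq_apply, r1, r2]
      nlinarith [hε.1, hε.2]
    have n3 : ‖1 - ((x : ℂ) + ε * I) ^ 2‖ ^ b ≤ (1 - x ^ 2) ^ b + (3:ℝ) ^ b := by
      rcases le_total 0 b with h | h
      · have := Real.rpow_le_rpow (norm_nonneg _) n2 h
        have : 0 ≤ (1 - x ^ 2) ^ b := by positivity
        linarith
      · have := Real.rpow_le_rpow_of_nonpos hxx n1 h
        have : 0 ≤ (3:ℝ) ^ b := by positivity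
        linarith
    have n4 : Real.exp (-(ρ * ((x : ℂ) + ε * I).im)) ≤ 1 := by
      rw [r2, Real.exp_le_one_iff]
      nlinarith [hε.1]
    calc _ ≤ 1 * (((1 - x ^ 2) ^ b + (3:ℝ) ^ b) * Real.exp (Real.pi / 2 * |v|)) := by gcongr
      _ = _ := one_mul _
  · exact ((bj_jacobi_int b hb).add intervalIntegrable_const).mul_const _
  · filter_upwards [MeasureTheory.Measure.ae_ne MeasureTheory.volume (1:ℝ)] with x hx hx2
    rw [Set.uIoc_of_le (by norm_num)] at hx2
    have hx1 : x < 1 := lt_of_le_of_ne hx2.2 hx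
    have hx0 := hx2.1
    have hc := (bjF_diff (b + v * I) ρ (z := (x:ℂ)) (by
      rw [Complex.ofReal_re, Complex.ofReal_im]; nlinarith)).continuousAt
    have h2 : Filter.Tendsto (fun ε : ℝ => (x : ℂ) + ε * I) (nhds 0) (nhds (x:ℂ)) := by
      have : Continuous (fun ε : ℝ => (x : ℂ) + ε * I) := by fun_prop
      simpa using this.tendsto 0
    exact hc.tendsto.comp (h2.mono_left nhdsWithin_le_nhds)

lemma bj_vert (b v ρ : ℝ) (hb : -1 < b) (hρ : 1 < ρ) :
    MeasureTheory.IntegrableOn (fun y : ℝ => bjF (b + v * I) ρ (1 + y * I)) (Set.Ioi 0) ∧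
    MeasureTheory.IntegrableOn (fun y : ℝ => bjF (b + v * I) ρ (-1 + y * I)) (Set.Ioi 0) := by
  constructor
  · refine MeasureTheory.IntegrableOn.congr_fun
      ((bj_integrable b v ρ hb hρ (s := -I) (Or.inr rfl)).const_mul (Complex.exp (I * ρ))) ?_ measurableSet_Ioi
    intro y hy
    exact (bjF_right _ ρ hy).symm
  · refine MeasureTheory.IntegrableOn.congr_fun
      ((bj_integrable b v ρ hb hρ (s := I) (Or.inl rfl)).const_mul (Complex.exp (-(I * ρ)))) ?_ measurableSet_Ioi
    intro y hy
    exact (bjF_left _ ρ hy).symm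

lemma bj_prim {f : ℝ → ℂ} (hf : MeasureTheory.IntegrableOn f (Set.Ioi 0)) {R : ℝ} (hR : 0 < R) :
    Filter.Tendsto (fun ε : ℝ => ∫ y in ε..R, f y) (nhdsWithin 0 (Set.Ioi 0)) (nhds (∫ y in (0:ℝ)..R, f y)) := by
  have h1 : MeasureTheory.IntegrableOn f (Set.uIcc 0 R) := by
    rw [Set.uIcc_of_le hR.le, integrableOn_Icc_iff_integrableOn_Ioc]
    exact hf.mono_set Set.Ioc_subset_Ioi_self
  have h2 := intervalIntegral.continuousOn_primitive_interval_left h1 0 (Set.left_mem_uIcc)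
  refine h2.tendsto.mono_left ?_
  rw [Set.uIcc_of_le hR.le]
  exact (nhdsWithin_le_iff).mpr (Icc_mem_nhdsGT hR)

lemma bj_rect (b v ρ : ℝ) (hb : -1 < b) (hρ : 1 < ρ) {R : ℝ} (hR : 0 < R) :
    (∫ x in (-1:ℝ)..1, bjF (b + v * I) ρ x) - (∫ x in (-1:ℝ)..1, bjF (b + v * I) ρ (x + R * I))
      + I • (∫ y in (0:ℝ)..R, bjF (b + v * I) ρ (1 + y * I))
      - I • (∫ y in (0:ℝ)..R, bjF (b + v * I) ρ (-1 + y * I)) = 0 := by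
  obtain ⟨v1, v2⟩ := bj_vert b v ρ hb hρ
  have hlim := (((bj_bottom b v ρ hb hρ).sub (tendsto_const_nhds
    (x := ∫ x in (-1:ℝ)..1, bjF (b + v * I) ρ (x + R * I)))).add ((bj_prim v1 hR).const_smul I)).sub
    ((bj_prim v2 hR).const_smul I)
  refine tendsto_nhds_unique hlim (tendsto_const_nhds.congr' ?_)
  have h1 : ∀ᶠ ε : ℝ in nhdsWithin 0 (Set.Ioi 0), ε ∈ Set.Ioo (0:ℝ) R := Ioo_mem_nhdsGT hR
  filter_upwards [h1] with ε hε
  have := Complex.integral_boundary_rect_eq_zero_of_differentiableOn (bjF (b + v * I) ρ)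
    (-1 + ε * I) (1 + R * I) (by
      intro z hz
      refine (bjF_diff _ ρ ?_).differentiableWithinAt
      rw [Complex.mem_reProdIm] at hz
      simp at hz
      rw [Set.uIcc_of_le hε.2.le] at hz
      obtain ⟨⟨z1, z2⟩, z3, z4⟩ := hz
      nlinarith [hε.1])
  simp at this
  simp only [smul_eq_mul]
  rw [← this]

lemma bj_top (b v ρ : ℝ) (hρ : 1 < ρ) :
    Filter.Tendsto (fun R : ℝ => ∫ x in (-1:ℝ)..1, bjF (b + v * I) ρ (x + R * I)) Filter.atTop (nhds 0) := by
  obtain ⟨D, hD, hDb⟩ := bj_exp (2 * |b|)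
  have hlim : Filter.Tendsto (fun R : ℝ => (D * Real.exp (Real.pi / 2 * |v|)) * Real.exp (-(R / 2)) * |(1:ℝ) - (-1)|)
      Filter.atTop (nhds 0) := by
    have : Filter.Tendsto (fun R : ℝ => Real.exp (-(R / 2))) Filter.atTop (nhds 0) :=
      Real.tendsto_exp_neg_atTop_nhds_zero.comp (Filter.tendsto_id.atTop_div_const (by norm_num))
    simpa using (this.const_mul (D * Real.exp (Real.pi / 2 * |v|))).mul_const |(1:ℝ) - (-1)|
  refine squeeze_zero_norm' ?_ hlim
  filter_upwards [Filter.eventually_ge_atTop (1:ℝ)] with R hR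
  apply intervalIntegral.norm_integral_le_of_norm_le_const
  intro x hx
  rw [Set.uIoc_of_le (by norm_num)] at hx
  have hxx : x ^ 2 ≤ 1 := by nlinarith [hx.1, hx.2]
  have r1 : ((x : ℂ) + R * I).re = x := by simp
  have r2 : ((x : ℂ) + R * I).im = R := by simp
  have hp : 0 < 1 - ((x : ℂ) + R * I).re ^ 2 + ((x : ℂ) + R * I).im ^ 2 := by
    rw [r1, r2]; nlinarith
  refine (bjF_norm b v ρ hp).trans ?_
  have n1 : 1 ≤ ‖1 - ((x : ℂ) + R * I) ^ 2‖ := by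
    refine le_trans ?_ (Complex.re_le_norm _)
    rw [bj_re, r1, r2]; nlinarith
  have n2 : ‖1 - ((x : ℂ) + R * I) ^ 2‖ ≤ (R + 2) ^ 2 := by
    refine (norm_sub_le _ _).trans ?_
    rw [norm_one, norm_pow, ← Complex.normSq_eq_norm_sq, Complex.normSq_apply, r1, r2]
    nlinarith
  have n3 : ‖1 - ((x : ℂ) + R * I) ^ 2‖ ^ b ≤ D * Real.exp (R / 2) := by
    calc _ ≤ ‖1 - ((x : ℂ) + R * I) ^ 2‖ ^ |b| := Real.rpow_le_rpow_of_exponent_le n1 (le_abs_self b)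
      _ ≤ ((R + 2) ^ 2) ^ |b| := Real.rpow_le_rpow (norm_nonneg _) n2 (abs_nonneg b)
      _ = (R + 2) ^ (2 * |b|) := by
        rw [← Real.rpow_natCast, ← Real.rpow_mul (by linarith)]; norm_num
      _ ≤ _ := hDb R (by linarith) _ (by linarith) le_rfl
  rw [r2]
  have n5 : Real.exp (-(ρ * R)) * Real.exp (R / 2) ≤ Real.exp (-(R / 2)) := by
    rw [← Real.exp_add]
    apply Real.exp_le_exp.mpr
    nlinarith
  calc _ ≤ Real.exp (-(ρ * R)) * ((D * Real.exp (R / 2)) * Real.exp (Real.pi / 2 * |v|)) := by gcongr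
    _ = D * Real.exp (Real.pi / 2 * |v|) * (Real.exp (-(ρ * R)) * Real.exp (R / 2)) := by ring
    _ ≤ _ := by gcongr

lemma bj_contour (b v ρ : ℝ) (hb : -1 < b) (hρ : 1 < ρ) (a : ℂ) (ha : a = b + v * I) :
    (∫ x in (-1:ℝ)..1, Complex.exp (I * ρ * x) * (1 - (x:ℂ) ^ 2) ^ a) =
      I * (Complex.exp (-(I * ρ)) *
          (∫ y in Set.Ioi (0:ℝ), (y : ℂ) ^ a * Complex.exp (-(ρ * y)) * ((y : ℂ) + 2 * I) ^ a)
        - Complex.exp (I * ρ) *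
          (∫ y in Set.Ioi (0:ℝ), (y : ℂ) ^ a * Complex.exp (-(ρ * y)) * ((y : ℂ) + 2 * (-I)) ^ a)) := by
  obtain ⟨v1, v2⟩ := bj_vert b v ρ hb hρ
  have hlim := (((tendsto_const_nhds (x := ∫ x in (-1:ℝ)..1, bjF (b + v * I) ρ x)).sub (bj_top b v ρ hρ)).add
    ((MeasureTheory.intervalIntegral_tendsto_integral_Ioi 0 v1 Filter.tendsto_id).const_smul I)).sub
    ((MeasureTheory.intervalIntegral_tendsto_integral_Ioi 0 v2 Filter.tendsto_id).const_smul I)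
  have h0 := tendsto_nhds_unique hlim (tendsto_const_nhds (x := (0:ℂ)) |>.congr' (by
    filter_upwards [Filter.eventually_gt_atTop (0:ℝ)] with R hR
    exact (bj_rect b v ρ hb hρ hR).symm))
  rw [← ha] at h0
  rw [MeasureTheory.setIntegral_congr_fun measurableSet_Ioi (fun y hy => bjF_right a ρ hy),
    MeasureTheory.setIntegral_congr_fun measurableSet_Ioi (fun y hy => bjF_left a ρ hy),
    MeasureTheory.integral_const_mul, MeasureTheory.integral_const_mul] at h0
  simp only [smul_eq_mul, sub_zero, bjF] at h0
  linear_combination h0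

lemma bj_poly (N : ℕ) : ∃ C : ℝ, 0 < C ∧ ∀ v : ℝ, (1 + |v|) ^ N ≤ C * Real.exp (Real.pi / 2 * |v|) := by
  refine ⟨N.factorial * Real.exp 1, by positivity, fun v => ?_⟩
  have h := Real.pow_div_factorial_le_exp (1 + |v|) (by positivity) N
  rw [div_le_iff₀ (by positivity)] at h
  calc _ ≤ _ := h
    _ = Real.exp 1 * Real.exp |v| * N.factorial := by rw [Real.exp_add]
    _ ≤ Real.exp 1 * Real.exp (Real.pi / 2 * |v|) * N.factorial := by
      gcongr
      nlinarith [Real.pi_gt_three, abs_nonneg v]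
    _ = _ := by ring

lemma bj_two_exp (v : ℝ) : Real.exp (Real.pi / 2 * |v|) * Real.exp (Real.pi / 2 * |v|) = Real.exp (Real.pi * |v|) := by
  rw [← Real.exp_add]; ring_nf

lemma bj_gamma_half : 1 ≤ ‖Complex.Gamma (1 / 2)‖ := by
  have : Complex.Gamma (1 / 2) = ((Real.Gamma (1 / 2) : ℝ) : ℂ) := by
    rw [← Complex.Gamma_ofReal]; push_cast; rfl
  rw [this, Complex.norm_real, Real.Gamma_one_half_eq, Real.norm_of_nonneg (Real.sqrt_nonneg _)]
  rw [Real.one_le_sqrt]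
  linarith [Real.pi_gt_three]

noncomputable def bjPref (ν : ℂ) (ρ : ℝ) : ℂ :=
  (ρ / 2 : ℂ) ^ ν / (Complex.Gamma (ν + 1 / 2) * Complex.Gamma (1 / 2))

lemma bj_pref_norm (μ v : ℝ) {ρ : ℝ} (hρ : 0 < ρ) :
    ‖bjPref (μ + v * I) ρ‖ ≤ (ρ / 2) ^ μ * ‖(Complex.Gamma (((μ + 1 / 2 : ℝ) : ℂ) + v * I))⁻¹‖ := by
  have h1 : ‖(ρ / 2 : ℂ) ^ (μ + v * I : ℂ)‖ = (ρ / 2) ^ μ := by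
    have := Complex.norm_cpow_eq_rpow_re_of_pos (half_pos hρ) (μ + v * I : ℂ)
    push_cast at this
    rw [this]; simp
  have h2 : (μ + v * I : ℂ) + 1 / 2 = ((μ + 1 / 2 : ℝ) : ℂ) + v * I := by push_cast; ring
  rw [bjPref, norm_div, norm_mul, h1, h2, norm_inv, ← div_eq_mul_inv]
  by_cases h0 : ‖Complex.Gamma (((μ + 1 / 2 : ℝ) : ℂ) + v * I)‖ = 0
  · rw [h0]; simp
  · have : 0 < ‖Complex.Gamma (((μ + 1 / 2 : ℝ) : ℂ) + v * I)‖ := lt_of_le_of_ne (norm_nonneg _) (Ne.symm h0)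
    gcongr
    nlinarith [bj_gamma_half]

lemma bj_side (μ : ℝ) (hμ : -(1 / 2) < μ) : ∃ C : ℝ, 0 < C ∧ ∀ s : ℂ, (s = I ∨ s = -I) →
    ∀ v ρ : ℝ, 1 < ρ → (1 + |v|) ^ 3 ≤ ρ → ∀ a : ℂ, a = (μ - 1 / 2 : ℝ) + v * I →
    ‖bjPref (μ + v * I) ρ *
      ((∫ y in Set.Ioi (0:ℝ), (y : ℂ) ^ a * Complex.exp (-(ρ * y)) * ((y : ℂ) + 2 * s) ^ a)
      - (2 * s) ^ a * ((1 / (ρ:ℂ)) ^ (a + 1) * Complex.Gamma (a + 1)))‖ ≤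
    C * Real.exp (Real.pi * |v|) * ρ ^ (-(3:ℝ) / 2) := by
  obtain ⟨b, hb⟩ : ∃ b : ℝ, b = μ - 1 / 2 := ⟨_, rfl⟩
  obtain ⟨C1, hC1, H1⟩ := bj_asymp b (by linarith)
  obtain ⟨C2, hC2, H2⟩ := bj_gamma (μ + 1 / 2) (by linarith)
  obtain ⟨C3, hC3, H3⟩ := bj_poly 2
  refine ⟨(1 / 2) ^ μ * (C2 * C1) + (1 / 2) ^ μ * ((|b| + 2) ^ 2 * 2 ^ (b - 1) * C3), by positivity, ?_⟩
  rintro s hs v ρ hρ hvρ a ha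
  rw [← hb] at ha
  have hρ0 : 0 < ρ := by linarith
  set A := (∫ y in Set.Ioi (0:ℝ), (y : ℂ) ^ a * Complex.exp (-(ρ * y)) * ((y : ℂ) + 2 * s) ^ a) with hA
  have e1 := H1 s hs v ρ hρ a ha
  rw [← hA] at e1
  have hp := bj_pref_norm μ v hρ0
  have hp2 := H2 v
  set G := ‖(Complex.Gamma (((μ + 1 / 2 : ℝ) : ℂ) + v * I))⁻¹‖ with hG
  have haG : a + 1 = ((μ + 1 / 2 : ℝ) : ℂ) + v * I := by rw [ha, hb]; push_cast; ring
  have hGne : Complex.Gamma (a + 1) ≠ 0 := by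
    apply Complex.Gamma_ne_zero_of_re_pos
    rw [haG]; simp; linarith
  have hane : a + 1 ≠ 0 := by
    intro h
    have := congrArg Complex.re h
    rw [haG] at this; simp at this; linarith
  have hG2 : Complex.Gamma (a + 2) = (a + 1) * Complex.Gamma (a + 1) := by
    rw [← Complex.Gamma_add_one _ hane]; ring_nf
  have hGG : G * ‖Complex.Gamma (a + 1)‖ = 1 := by
    rw [hG, ← haG, norm_inv, inv_mul_cancel₀ (norm_ne_zero_iff.mpr hGne)]
  have habs := norm_add_le (b : ℂ) (v * I)
  rw [← ha] at habs
  simp only [norm_mul, Complex.norm_real, Complex.norm_I, Real.norm_eq_abs, mul_one] at habs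
  have ha1 : ‖a‖ ≤ (|b| + 2) * (1 + |v|) := by nlinarith [abs_nonneg v, abs_nonneg b]
  have ha2 : ‖a + 1‖ ≤ (|b| + 2) * (1 + |v|) := by
    refine (norm_add_le _ _).trans ?_
    rw [norm_one]
    nlinarith [abs_nonneg v, abs_nonneg b]
  have hsn : ‖2 * s‖ = 2 := by rcases hs with rfl | rfl <;> simp
  have hs0 : 2 * s ≠ 0 := by rw [← norm_ne_zero_iff, hsn]; norm_num
  have hsr : 0 ≤ (2 * s).re := by rcases hs with rfl | rfl <;> simp
  have e2 := bj_cpow hs0 hsr (a - 1)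
  have r1 : (a - 1).re = b - 1 := by simp [ha]
  have r2 : (a - 1).im = v := by simp [ha]
  rw [hsn, r1, r2] at e2
  have e3 : ‖(1 / (ρ : ℂ)) ^ (a + 2)‖ = ρ ^ (-b - 2) := by
    have := Complex.norm_cpow_eq_rpow_re_of_pos (one_div_pos.mpr hρ0) (a + 2)
    push_cast at this
    rw [this, show (a + 2).re = b + 2 by simp [ha], one_div, Real.inv_rpow hρ0.le, ← Real.rpow_neg hρ0.le]
    congr 1; ring
  set E := Real.exp (Real.pi / 2 * |v|) with hE
  have hE0 : 0 < E := Real.exp_pos _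
  have hEE : E * E = Real.exp (Real.pi * |v|) := bj_two_exp v
  have hρμ : (ρ / 2) ^ μ = (1 / 2) ^ μ * ρ ^ μ := by
    rw [← Real.mul_rpow (by norm_num) hρ0.le]; congr 1; ring
  set S := a * (2 * s) ^ (a - 1) * ((1 / (ρ:ℂ)) ^ (a + 2) * Complex.Gamma (a + 2)) with hS
  set M := (2 * s) ^ a * ((1 / (ρ:ℂ)) ^ (a + 1) * Complex.Gamma (a + 1)) with hM
  have t1 : ‖bjPref (μ + v * I) ρ * (A - M - S)‖ ≤ (1 / 2) ^ μ * (C2 * C1) * Real.exp (Real.pi * |v|) * ρ ^ (-(3:ℝ) / 2) := by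
    rw [norm_mul]
    calc _ ≤ ((ρ / 2) ^ μ * (C2 * (1 + |v|) * E)) * (C1 * (1 + |v|) ^ 2 * E * ρ ^ (-b - 3)) := by
          gcongr
          exact hp.trans (by gcongr)
      _ = (1 / 2) ^ μ * (C2 * C1) * (E * E) * (ρ ^ μ * ρ ^ (-b - 3) * (1 + |v|) ^ 3) := by rw [hρμ]; ring
      _ ≤ (1 / 2) ^ μ * (C2 * C1) * (E * E) * (ρ ^ μ * ρ ^ (-b - 3) * ρ) := by gcongr
      _ = _ := by
        rw [hEE]
        congr 1
        nth_rewrite 3 [← Real.rpow_one ρ]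
        rw [← Real.rpow_add hρ0, ← Real.rpow_add hρ0]
        congr 1; rw [hb]; ring
  have t2 : ‖bjPref (μ + v * I) ρ * S‖ ≤ (1 / 2) ^ μ * ((|b| + 2) ^ 2 * 2 ^ (b - 1) * C3) * Real.exp (Real.pi * |v|) * ρ ^ (-(3:ℝ) / 2) := by
    rw [norm_mul, hS, hG2, norm_mul, norm_mul, norm_mul, norm_mul, e3]
    calc _ ≤ ((ρ / 2) ^ μ * G) * (((|b| + 2) * (1 + |v|)) * (2 ^ (b - 1) * E) *
          (ρ ^ (-b - 2) * (((|b| + 2) * (1 + |v|)) * ‖Complex.Gamma (a + 1)‖))) := by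
          gcongr
      _ = (1 / 2) ^ μ * ((|b| + 2) ^ 2 * 2 ^ (b - 1) * (1 + |v|) ^ 2) * E * (ρ ^ μ * ρ ^ (-b - 2)) *
          (G * ‖Complex.Gamma (a + 1)‖) := by rw [hρμ]; ring
      _ ≤ (1 / 2) ^ μ * ((|b| + 2) ^ 2 * 2 ^ (b - 1) * (C3 * E)) * E * (ρ ^ μ * ρ ^ (-b - 2)) *
          (G * ‖Complex.Gamma (a + 1)‖) := by gcongr; exact H3 v
      _ = (1 / 2) ^ μ * ((|b| + 2) ^ 2 * 2 ^ (b - 1) * C3) * (E * E) * (ρ ^ μ * ρ ^ (-b - 2)) := by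
          rw [hGG]; ring
      _ = _ := by
        rw [hEE, ← Real.rpow_add hρ0]
        congr 2; rw [hb]; ring
  have : bjPref (μ + v * I) ρ * (A - M) = bjPref (μ + v * I) ρ * (A - M - S) + bjPref (μ + v * I) ρ * S := by ring
  rw [this]
  refine (norm_add_le _ _).trans ?_
  linarith

lemma bj_main (μ v ρ : ℝ) (hμ : -(1 / 2) < μ) (hρ : 1 < ρ) (a : ℂ) (ha : a = (μ - 1 / 2 : ℝ) + v * I) :
    bjPref (μ + v * I) ρ * (I * (Complex.exp (-(I * ρ)) *
        ((2 * I) ^ a * ((1 / (ρ:ℂ)) ^ (a + 1) * Complex.Gamma (a + 1)))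
      - Complex.exp (I * ρ) *
        ((2 * (-I)) ^ a * ((1 / (ρ:ℂ)) ^ (a + 1) * Complex.Gamma (a + 1))))) =
    (((2 / (Real.pi * ρ)) ^ ((1 : ℝ) / 2) : ℝ) : ℂ) *
            Complex.cos ((ρ : ℂ) - (Real.pi / 2 : ℝ) * ((μ : ℂ) + (v : ℂ) * I) -
              (Real.pi / 4 : ℝ)) := by
  have hρ0 : 0 < ρ := by linarith
  have hpi := Real.pi_pos
  have hν : (μ + v * I : ℂ) = a + 1 / 2 := by rw [ha]; push_cast; ring
  have hGne : Complex.Gamma (a + 1) ≠ 0 := by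
    apply Complex.Gamma_ne_zero_of_re_pos
    rw [ha]; simp; linarith
  have hρc : (ρ : ℂ) ≠ 0 := by exact_mod_cast hρ0.ne'
  have q1 : (ρ / 2 : ℂ) ^ (a + 1 / 2) = Complex.exp (((Real.log ρ : ℂ) - Real.log 2) * (a + 1 / 2)) := by
    have h : (ρ / 2 : ℂ) = ((ρ / 2 : ℝ) : ℂ) := by push_cast; ring
    rw [Complex.cpow_def_of_ne_zero (by simpa using hρc), h, ← Complex.ofReal_log (by positivity),
      Real.log_div hρ0.ne' (by norm_num)]
    push_cast; rfl
  have q2 : (1 / (ρ:ℂ)) ^ (a + 1) = Complex.exp (-(Real.log ρ : ℂ) * (a + 1)) := by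
    have h : (1 / (ρ:ℂ)) = ((ρ⁻¹ : ℝ) : ℂ) := by push_cast; ring
    rw [Complex.cpow_def_of_ne_zero (by simpa using hρc), h, ← Complex.ofReal_log (by positivity),
      Real.log_inv]
    push_cast; rfl
  have q3 : (2 * I) ^ a = Complex.exp (((Real.log 2 : ℂ) + Real.pi / 2 * I) * a) := by
    have h : (2 * I) = ((2 : ℝ) : ℂ) * I := by push_cast; ring
    rw [Complex.cpow_def_of_ne_zero (by simp), h, Complex.log_ofReal_mul (by norm_num) (by simp), Complex.log_I]
  have q4 : (2 * (-I)) ^ a = Complex.exp (((Real.log 2 : ℂ) - Real.pi / 2 * I) * a) := by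
    have h : (2 * (-I)) = ((2 : ℝ) : ℂ) * (-I) := by push_cast; ring
    rw [Complex.cpow_def_of_ne_zero (by simp), h, Complex.log_ofReal_mul (by norm_num) (by simp), Complex.log_neg_I]
    ring_nf
  have q5 : Complex.Gamma (1 / 2) = Complex.exp ((Real.log Real.pi : ℂ) / 2) := by
    rw [Complex.Gamma_one_half_eq, Complex.cpow_def_of_ne_zero (by exact_mod_cast hpi.ne'),
      ← Complex.ofReal_log hpi.le]
    ring_nf
  have q6 : (((2 / (Real.pi * ρ)) ^ ((1 : ℝ) / 2) : ℝ) : ℂ) =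
      Complex.exp (((Real.log 2 : ℂ) - Real.log Real.pi - Real.log ρ) / 2) := by
    rw [Real.rpow_def_of_pos (by positivity), Real.log_div (by norm_num) (by positivity),
      Real.log_mul hpi.ne' hρ0.ne']
    push_cast; ring_nf
  have q7 : (2:ℂ)⁻¹ = Complex.exp (-(Real.log 2 : ℂ)) := by
    rw [← Complex.ofReal_neg, ← Complex.ofReal_exp, Real.exp_neg, Real.exp_log (by norm_num)]
    push_cast; rfl
  have q8 : I = Complex.exp (Real.pi / 2 * I) := Complex.exp_pi_div_two_mul_I.symm
  have q9 : -I = Complex.exp (-(Real.pi / 2 * I)) := by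
    rw [Complex.exp_neg, Complex.exp_pi_div_two_mul_I, Complex.inv_I]
  rw [bjPref, hν, show a + 1 / 2 + 1 / 2 = a + 1 by ring, q1, q2, q3, q4, q5, q6, Complex.cos]
  generalize (Real.log ρ : ℂ) = Lr
  generalize (Real.log Real.pi : ℂ) = Lp
  generalize hl : (Real.log 2 : ℂ) = l at q7 ⊢
  set Γ := Complex.Gamma (a + 1)
  have hx := Complex.exp_ne_zero (Lp / 2)
  have step : Complex.exp ((Lr - l) * (a + 1 / 2)) / (Γ * Complex.exp (Lp / 2)) *
      (I * (Complex.exp (-(I * ρ)) * (Complex.exp ((l + Real.pi / 2 * I) * a) * (Complex.exp (-Lr * (a + 1)) * Γ))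
        - Complex.exp (I * ρ) * (Complex.exp ((l - Real.pi / 2 * I) * a) * (Complex.exp (-Lr * (a + 1)) * Γ))))
      = Complex.exp ((Lr - l) * (a + 1 / 2)) * Complex.exp (-(Lp / 2)) *
        (I * (Complex.exp (-(I * ρ)) * (Complex.exp ((l + Real.pi / 2 * I) * a) * Complex.exp (-Lr * (a + 1)))))
      + Complex.exp ((Lr - l) * (a + 1 / 2)) * Complex.exp (-(Lp / 2)) *
        ((-I) * (Complex.exp (I * ρ) * (Complex.exp ((l - Real.pi / 2 * I) * a) * Complex.exp (-Lr * (a + 1))))) := by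
    rw [Complex.exp_neg (Lp / 2)]
    field_simp
    ring
  rw [step]
  have c1 : Complex.exp ((Lr - l) * (a + 1 / 2)) * Complex.exp (-(Lp / 2)) *
        (I * (Complex.exp (-(I * ρ)) * (Complex.exp ((l + Real.pi / 2 * I) * a) * Complex.exp (-Lr * (a + 1)))))
      = Complex.exp ((l - Lp - Lr) / 2) * (2:ℂ)⁻¹ * Complex.exp (-((ρ : ℂ) - (Real.pi / 2 : ℝ) * (a + 1 / 2) -
              (Real.pi / 4 : ℝ)) * I) := by
    rw [q7]
    conv_lhs => rw [show ∀ x : ℂ, I * x = Complex.exp (Real.pi / 2 * I) * x from fun x => by rw [← q8]]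
    simp only [← Complex.exp_add]
    congr 1
    push_cast
    ring
  have c2 : Complex.exp ((Lr - l) * (a + 1 / 2)) * Complex.exp (-(Lp / 2)) *
        ((-I) * (Complex.exp (I * ρ) * (Complex.exp ((l - Real.pi / 2 * I) * a) * Complex.exp (-Lr * (a + 1)))))
      = Complex.exp ((l - Lp - Lr) / 2) * (2:ℂ)⁻¹ * Complex.exp (((ρ : ℂ) - (Real.pi / 2 : ℝ) * (a + 1 / 2) -
              (Real.pi / 4 : ℝ)) * I) := by
    rw [q7, q9]
    simp only [← Complex.exp_add]
    congr 1
    push_cast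
    ring
  rw [c1, c2]
  ring

lemma bj_large (μ : ℝ) (hμ : -(1 / 2) < μ) : ∃ C : ℝ, 0 < C ∧ ∀ v ρ : ℝ, 1 < ρ → (1 + |v|) ^ 3 ≤ ρ →
      ‖besselJ ((μ : ℂ) + (v : ℂ) * I) ρ -
          (((2 / (Real.pi * ρ)) ^ ((1 : ℝ) / 2) : ℝ) : ℂ) *
            Complex.cos ((ρ : ℂ) - (Real.pi / 2 : ℝ) * ((μ : ℂ) + (v : ℂ) * I) -
              (Real.pi / 4 : ℝ))‖ ≤
        C * Real.exp (Real.pi * |v|) * ρ ^ (-(3 : ℝ) / 2) := by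
  obtain ⟨C, hC, H⟩ := bj_side μ hμ
  refine ⟨C + C, by positivity, fun v ρ hρ hvρ => ?_⟩
  obtain ⟨a, ha⟩ : ∃ a : ℂ, a = (μ - 1 / 2 : ℝ) + v * I := ⟨_, rfl⟩
  rw [← bj_main μ v ρ hμ hρ a ha]
  have hc := bj_contour (μ - 1 / 2) v ρ (by linarith) hρ a ha
  have hJ : besselJ ((μ : ℂ) + (v : ℂ) * I) ρ = bjPref (μ + v * I) ρ *
      ∫ x in (-1:ℝ)..1, Complex.exp (I * ρ * x) * (1 - (x:ℂ) ^ 2) ^ a := by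
    rw [besselJ, bjPref, ha, show ((μ - 1 / 2 : ℝ) : ℂ) + v * I = (μ : ℂ) + v * I - 1 / 2 by push_cast; ring]
  rw [hJ, hc]
  have h1 := H I (Or.inl rfl) v ρ hρ hvρ a ha
  have h2 := H (-I) (Or.inr rfl) v ρ hρ hvρ a ha
  generalize (∫ y in Set.Ioi (0:ℝ), (y : ℂ) ^ a * Complex.exp (-(ρ * y)) * ((y : ℂ) + 2 * I) ^ a) = A1 at *
  generalize (∫ y in Set.Ioi (0:ℝ), (y : ℂ) ^ a * Complex.exp (-(ρ * y)) * ((y : ℂ) + 2 * (-I)) ^ a) = A2 at *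
  generalize (2 * I) ^ a * ((1 / (ρ:ℂ)) ^ (a + 1) * Complex.Gamma (a + 1)) = M1 at *
  generalize (2 * (-I)) ^ a * ((1 / (ρ:ℂ)) ^ (a + 1) * Complex.Gamma (a + 1)) = M2 at *
  generalize bjPref (μ + v * I) ρ = P at *
  have e : P * (I * (Complex.exp (-(I * ρ)) * A1 - Complex.exp (I * ρ) * A2)) -
      P * (I * (Complex.exp (-(I * ρ)) * M1 - Complex.exp (I * ρ) * M2)) =
      I * Complex.exp (-(I * ρ)) * (P * (A1 - M1)) - I * Complex.exp (I * ρ) * (P * (A2 - M2)) := by ring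
  rw [e]
  refine (norm_sub_le _ _).trans ?_
  have n1 : ‖I * Complex.exp (-(I * ρ))‖ = 1 := by
    rw [norm_mul, Complex.norm_exp]; simp
  have n2 : ‖I * Complex.exp (I * ρ)‖ = 1 := by
    rw [norm_mul, Complex.norm_exp]; simp
  rw [norm_mul, norm_mul (I * Complex.exp (I * ρ)), n1, n2]
  linarith

lemma bj_small (μ : ℝ) (hμ : -(1 / 2) < μ) : ∃ C : ℝ, 0 < C ∧ ∀ v ρ : ℝ, 1 < ρ → ρ ≤ (1 + |v|) ^ 3 →
      ‖besselJ ((μ : ℂ) + (v : ℂ) * I) ρ -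
          (((2 / (Real.pi * ρ)) ^ ((1 : ℝ) / 2) : ℝ) : ℂ) *
            Complex.cos ((ρ : ℂ) - (Real.pi / 2 : ℝ) * ((μ : ℂ) + (v : ℂ) * I) -
              (Real.pi / 4 : ℝ))‖ ≤
        C * Real.exp (Real.pi * |v|) * ρ ^ (-(3 : ℝ) / 2) := by
  obtain ⟨C2, hC2, H2⟩ := bj_gamma (μ + 1 / 2) (by linarith)
  obtain ⟨N, hN⟩ := exists_nat_ge (μ + 3 / 2)
  obtain ⟨C3, hC3, H3⟩ := bj_poly (3 * N + 1)
  obtain ⟨C4, hC4, H4⟩ := bj_poly 3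
  set B : ℝ := ∫ t in (-1:ℝ)..1, ‖(1 - (t : ℂ) ^ 2) ^ ((μ : ℂ) - 1 / 2)‖ with hB
  have hB0 : 0 ≤ B := intervalIntegral.integral_nonneg (by norm_num) (fun _ _ => norm_nonneg _)
  refine ⟨(1 / 2) ^ μ * C2 * B * C3 + C4, by positivity, fun v ρ hρ hρv => ?_⟩
  have hρ0 : 0 < ρ := by linarith
  have hp := (bj_pref_norm μ v hρ0)
  have hp2 := H2 v
  set E := Real.exp (Real.pi / 2 * |v|) with hE
  have hE0 : 0 < E := Real.exp_pos _
  have hEE : E * E = Real.exp (Real.pi * |v|) := bj_two_exp v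
  have hρμ : (ρ / 2) ^ μ = (1 / 2) ^ μ * ρ ^ μ := by
    rw [← Real.mul_rpow (by norm_num) hρ0.le]; congr 1; ring
  have hint : ‖∫ t in (-1 : ℝ)..1, Complex.exp (I * ρ * t) * ((1 - (t : ℂ) ^ 2) ^ ((μ + v * I : ℂ) - 1 / 2))‖ ≤ B := by
    rw [hB]
    refine (intervalIntegral.norm_integral_le_integral_norm (by norm_num)).trans (le_of_eq ?_)
    apply intervalIntegral.integral_congr_ae
    filter_upwards [MeasureTheory.Measure.ae_ne MeasureTheory.volume (1:ℝ)] with x hx hx2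
    rw [Set.uIoc_of_le (by norm_num)] at hx2
    have hx1 : x < 1 := lt_of_le_of_ne hx2.2 hx
    have hx0 := hx2.1
    have hxx : 0 < 1 - x ^ 2 := by nlinarith
    have hc : (1 - (x : ℂ) ^ 2) = ((1 - x ^ 2 : ℝ) : ℂ) := by push_cast; ring
    rw [norm_mul, Complex.norm_exp, hc, Complex.norm_cpow_eq_rpow_re_of_pos hxx,
      Complex.norm_cpow_eq_rpow_re_of_pos hxx]
    simp
  have hJ : ‖besselJ ((μ : ℂ) + (v : ℂ) * I) ρ‖ ≤ (1 / 2) ^ μ * C2 * B * C3 * Real.exp (Real.pi * |v|) * ρ ^ (-(3 : ℝ) / 2) := by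
    have hpow : ρ ^ (μ + 3 / 2) ≤ (1 + |v|) ^ (3 * N) := by
      calc ρ ^ (μ + 3 / 2) ≤ ρ ^ (N : ℝ) := Real.rpow_le_rpow_of_exponent_le hρ.le hN
        _ = ρ ^ N := Real.rpow_natCast _ _
        _ ≤ ((1 + |v|) ^ 3) ^ N := by gcongr
        _ = _ := by rw [pow_mul]
    have hsplit : ρ ^ μ = ρ ^ (μ + 3 / 2) * ρ ^ (-(3 : ℝ) / 2) := by
      rw [← Real.rpow_add hρ0]; congr 1; ring
    change ‖bjPref (μ + v * I) ρ * _‖ ≤ _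
    rw [norm_mul]
    calc _ ≤ ((ρ / 2) ^ μ * (C2 * (1 + |v|) * E)) * B := by
          gcongr
          exact hp.trans (by gcongr)
      _ = (1 / 2) ^ μ * C2 * B * (ρ ^ (μ + 3 / 2) * (1 + |v|)) * E * ρ ^ (-(3 : ℝ) / 2) := by
          rw [hρμ, hsplit]; ring
      _ ≤ (1 / 2) ^ μ * C2 * B * ((1 + |v|) ^ (3 * N) * (1 + |v|)) * E * ρ ^ (-(3 : ℝ) / 2) := by gcongr
      _ = (1 / 2) ^ μ * C2 * B * ((1 + |v|) ^ (3 * N + 1)) * E * ρ ^ (-(3 : ℝ) / 2) := by rw [pow_succ]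
      _ ≤ (1 / 2) ^ μ * C2 * B * (C3 * E) * E * ρ ^ (-(3 : ℝ) / 2) := by gcongr; exact H3 v
      _ = _ := by rw [← hEE]; ring
  have hcos : ∀ θ : ℂ, ‖Complex.cos θ‖ ≤ Real.exp |θ.im| := by
    intro θ
    rw [Complex.cos, norm_div, Complex.norm_ofNat, div_le_iff₀ (by norm_num)]
    refine (norm_add_le _ _).trans ?_
    rw [Complex.norm_exp, Complex.norm_exp]
    have h1 : Real.exp (θ * I).re ≤ Real.exp |θ.im| := by
      apply Real.exp_le_exp.mpr; simpa using neg_le_abs θ.im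
    have h2 : Real.exp (-θ * I).re ≤ Real.exp |θ.im| := by
      apply Real.exp_le_exp.mpr; simpa using le_abs_self θ.im
    linarith
  have hM : ‖(((2 / (Real.pi * ρ)) ^ ((1 : ℝ) / 2) : ℝ) : ℂ) *
            Complex.cos ((ρ : ℂ) - (Real.pi / 2 : ℝ) * ((μ : ℂ) + (v : ℂ) * I) -
              (Real.pi / 4 : ℝ))‖ ≤ C4 * Real.exp (Real.pi * |v|) * ρ ^ (-(3 : ℝ) / 2) := by
    have hpi := Real.pi_pos
    rw [norm_mul, Complex.norm_real, Real.norm_of_nonneg (by positivity)]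
    have c := hcos ((ρ : ℂ) - (Real.pi / 2 : ℝ) * ((μ : ℂ) + (v : ℂ) * I) - (Real.pi / 4 : ℝ))
    have him : |((ρ : ℂ) - (Real.pi / 2 : ℝ) * ((μ : ℂ) + (v : ℂ) * I) - (Real.pi / 4 : ℝ)).im| = Real.pi / 2 * |v| := by
      have : ((ρ : ℂ) - (Real.pi / 2 : ℝ) * ((μ : ℂ) + (v : ℂ) * I) - (Real.pi / 4 : ℝ)).im = -(Real.pi / 2 * v) := by
        simp only [Complex.sub_im, Complex.ofReal_im, Complex.im_ofReal_mul, Complex.add_im, Complex.I_im, mul_one]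
        ring
      rw [this, abs_neg, abs_mul, abs_of_pos (by positivity)]
    rw [him] at c
    have d : (2 / (Real.pi * ρ)) ^ ((1 : ℝ) / 2) ≤ ρ ^ (-(1 : ℝ) / 2) := by
      rw [show -(1:ℝ) / 2 = -(1 / 2) by ring, Real.rpow_neg hρ0.le, ← Real.inv_rpow hρ0.le]
      apply Real.rpow_le_rpow (by positivity) _ (by norm_num)
      rw [div_le_iff₀ (by positivity)]
      field_simp
      linarith [Real.pi_gt_three]
    have hsplit : ρ ^ (-(1 : ℝ) / 2) = ρ * ρ ^ (-(3 : ℝ) / 2) := by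
      nth_rewrite 2 [← Real.rpow_one ρ]
      rw [← Real.rpow_add hρ0]; congr 1; ring
    calc _ ≤ ρ ^ (-(1 : ℝ) / 2) * E := by gcongr
      _ = ρ * ρ ^ (-(3 : ℝ) / 2) * E := by rw [hsplit]
      _ ≤ (C4 * E) * ρ ^ (-(3 : ℝ) / 2) * E := by
        gcongr
        exact hρv.trans (H4 v)
      _ = _ := by rw [← hEE]; ring
  refine (norm_sub_le _ _).trans ?_
  linarith

/-- large-argument asymptotics of the Bessel function of complex
order μ + iv with the explicit growth e^{π|v|} in the imaginary part. -/
theorem stmt18 (μ : ℝ) (hμ : -(1 / 2) < μ) :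
    ∃ C : ℝ, 0 < C ∧ ∀ v ρ : ℝ, 1 < ρ →
      ‖besselJ ((μ : ℂ) + (v : ℂ) * I) ρ -
          (((2 / (Real.pi * ρ)) ^ ((1 : ℝ) / 2) : ℝ) : ℂ) *
            Complex.cos ((ρ : ℂ) - (Real.pi / 2 : ℝ) * ((μ : ℂ) + (v : ℂ) * I) -
              (Real.pi / 4 : ℝ))‖ ≤
        C * Real.exp (Real.pi * |v|) * ρ ^ (-(3 : ℝ) / 2) := by
  obtain ⟨C1, hC1, H1⟩ := bj_large μ hμ
  obtain ⟨C2, hC2, H2⟩ := bj_small μ hμ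
  refine ⟨C1 + C2, by positivity, fun v ρ hρ => ?_⟩
  have hX : 0 ≤ Real.exp (Real.pi * |v|) * ρ ^ (-(3 : ℝ) / 2) := by
    have : 0 < ρ := by linarith
    positivity
  rcases le_total ((1 + |v|) ^ 3) ρ with h | h
  · refine (H1 v ρ hρ h).trans ?_
    nlinarith [mul_nonneg hC2.le hX]
  · refine (H2 v ρ hρ h).trans ?_
    nlinarith [mul_nonneg hC1.le hX]
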